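/- Suppose n = ∞. Let W and W' be smooth representations of G on k-vector spaces (G acting k-linearly, stabilizers of vectors open) which are homotopy invariant. Equip F ⊗_k W and F ⊗_k W' with the smooth semilinear G-actions g(f ⊗ w) = g(f) ⊗ g(w). Then the map f ↦ id_F ⊗ f, from the space of k-linear G-equivariant maps W → W' to the space of F-linear G-equivariant maps F ⊗_k W → F ⊗_k W', is bijective. -/

import Mathlib

universe u v

open scoped TensorProduct

/-- The topology of pointwise convergence on `Aut(F/k)`, where `F` carries the
discrete topology: a base of open neighbourhoods of the identity is given by
the pointwise stabilizers of finite subsets of `F`. -/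
def autTop (k F : Type*) [Field k] [Field F] [Algebra k F] :
    TopologicalSpace (F ≃ₐ[k] F) :=
  TopologicalSpace.induced (fun g (x : F) => g x)
    (@Pi.topologicalSpace F (fun _ => F) (fun _ => ⊥))

section Reps

variable {k F : Type*} [Field k] [Field F] [Algebra k F]
variable {W : Type u} [AddCommGroup W] [Module k W]

/-- The subspace of vectors fixed by a subgroup `U` of `G = Aut(F/k)`
(for a `k`-linear representation). -/
def fixedSubmodule (ρ : (F ≃ₐ[k] F) →* (W ≃ₗ[k] W))
    (U : Subgroup (F ≃ₐ[k] F)) : Submodule k W where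
  carrier := {w | ∀ g ∈ U, ρ g w = w}
  add_mem' := by
    intro a b ha hb g hg
    rw [map_add, ha g hg, hb g hg]
  zero_mem' := fun g _ => map_zero _
  smul_mem' := by
    intro c w hw g hg
    rw [map_smul, hw g hg]

/-- A `k`-linear representation of `G = Aut(F/k)` is smooth if the stabilizer
of every vector is open. -/
def IsSmoothRep (ρ : (F ≃ₐ[k] F) →* (W ≃ₗ[k] W)) : Prop :=
  ∀ w : W, @IsOpen _ (autTop k F) {g : F ≃ₐ[k] F | ρ g w = w}

/-- `L'` is a purely transcendental extension of the intermediate field `L`: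
`L'` is generated over `L` by a set of algebraically independent elements. -/
def IsPurelyTranscendentalExt (L L' : IntermediateField k F) : Prop :=
  ∃ s : Set F, AlgebraicIndependent ↥L (Subtype.val : s → F) ∧
    (IntermediateField.adjoin ↥L s).restrictScalars k = L'

/-- A `k`-linear representation of `G = Aut(F/k)` is homotopy invariant if
`W^{G_{F/L}} = W^{G_{F/L'}}` whenever `L'/L` is a purely transcendental
subextension of `F/k`. -/
def IsHomotopyInvariantRep (ρ : (F ≃ₐ[k] F) →* (W ≃ₗ[k] W)) : Prop :=
  ∀ L L' : IntermediateField k F, IsPurelyTranscendentalExt L L' →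
    fixedSubmodule ρ L.fixingSubgroup = fixedSubmodule ρ L'.fixingSubgroup

end Reps

section Auxiliary

open Cardinal

theorem IsAlgClosed.exists_algebraMap_eq_of_isAlgebraic {k F : Type*} [Field k] [IsAlgClosed k]
    [Field F] [Algebra k F] {f : F} (hf : IsAlgebraic k f) : ∃ c : k, algebraMap k F c = f := by
  have hdeg := IsAlgClosed.degree_eq_one_of_irreducible k (minpoly.irreducible hf.isIntegral)
  exact minpoly.mem_range_of_degree_eq_one k f hdeg

/-- A nonzero element of a finitely generated domain over an algebraically closed field does not
vanish at some rational point. -/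
theorem Algebra.FiniteType.exists_algHom_apply_ne_zero {k A : Type*} [Field k] [IsAlgClosed k]
    [CommRing A] [IsDomain A] [Algebra k A] [Algebra.FiniteType k A] {c : A} (hc : c ≠ 0) :
    ∃ χ : A →ₐ[k] k, χ c ≠ 0 := by
  let B := Localization.Away c
  have : Nontrivial B := (IsLocalization.injective B (M := Submonoid.powers c)
    (powers_le_nonZeroDivisors_of_noZeroDivisors hc)).nontrivial
  have : Algebra.FiniteType A B := IsLocalization.finiteType_of_monoid_fg (Submonoid.powers c) B
  have : Algebra.FiniteType k B := Algebra.FiniteType.trans (S := A) inferInstance inferInstance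
  obtain ⟨m, hm⟩ := Ideal.exists_maximal B
  let : Field (B ⧸ m) := Ideal.Quotient.field m
  have := finite_of_finite_type_of_isJacobsonRing k (B ⧸ m)
  let e : k ≃ₐ[k] (B ⧸ m) := AlgEquiv.ofBijective (Algebra.ofId k (B ⧸ m))
    IsAlgClosed.algebraMap_bijective_of_isIntegral
  refine ⟨e.symm.toAlgHom.comp ((Ideal.Quotient.mkₐ k m).comp (IsScalarTower.toAlgHom k A B)), ?_⟩
  have hu := ((IsLocalization.Away.algebraMap_isUnit (S := B) c).map (Ideal.Quotient.mkₐ k m)).map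
    e.symm
  exact hu.ne_zero

theorem Algebra.TensorProduct.isDomain_of_isAlgClosed (k A B : Type*) [Field k] [IsAlgClosed k]
    [CommRing A] [IsDomain A] [Algebra k A] [Algebra.FiniteType k A]
    [CommRing B] [IsDomain B] [Algebra k B] : IsDomain (A ⊗[k] B) := by
  have : NoZeroDivisors (A ⊗[k] B) := by
    refine ⟨fun {z w} hzw => ?_⟩
    by_contra! hne
    let b := Algebra.TensorProduct.basis A (Module.Free.chooseBasis k B)
    have coord_ne : ∀ z : A ⊗[k] B, z ≠ 0 → ∃ i, b.repr z i ≠ 0 := by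
      intro z hz
      by_contra! h
      exact hz (b.repr.map_eq_zero_iff.mp (Finsupp.ext h))
    obtain ⟨i, hi⟩ := coord_ne z hne.1
    obtain ⟨j, hj⟩ := coord_ne w hne.2
    obtain ⟨χ, hχ⟩ := Algebra.FiniteType.exists_algHom_apply_ne_zero (k := k) (mul_ne_zero hi hj)
    rw [map_mul] at hχ
    let ev : A ⊗[k] B →ₐ[k] B :=
      Algebra.TensorProduct.lift ((Algebra.ofId k B).comp χ) (AlgHom.id k B)
        (fun _ _ => Commute.all _ _)
    have hev : ∀ (z : A ⊗[k] B) i,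
        (Module.Free.chooseBasis k B).repr (ev z) i = χ (b.repr z i) := by
      intro z i
      induction z with
      | zero => simp
      | add x y hx hy => simp [hx, hy]
      | tmul x y => simp [ev, b, Algebra.ofId_apply, ← Algebra.smul_def]
    have ev_ne : ∀ (z : A ⊗[k] B) i, χ (b.repr z i) ≠ 0 → ev z ≠ 0 := by
      intro z i h h0
      rw [← hev, h0] at h
      simp at h
    have h := congrArg ev hzw
    rw [map_mul, map_zero, mul_eq_zero] at h
    rcases h with h | h
    · exact ev_ne z i (left_ne_zero_of_mul hχ) h
    · exact ev_ne w j (right_ne_zero_of_mul hχ) h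
  exact NoZeroDivisors.to_isDomain _

theorem IsAlgClosed.exists_ringEquiv_of_isTranscendenceBasis {R E E' : Type*} [CommRing R]
    [Field E] [Field E'] [Algebra R E] [Algebra R E'] [IsAlgClosed E] [IsAlgClosed E']
    {ι : Type*} {v : ι → E} {w : ι → E'} (hv : IsTranscendenceBasis R v)
    (hw : IsTranscendenceBasis R w) :
    ∃ σ : E ≃+* E', ∀ r, σ (algebraMap R E r) = algebraMap R E' r := by
  let := IsAlgClosed.isAlgClosure_of_transcendence_basis v hv
  let := IsAlgClosed.isAlgClosure_of_transcendence_basis w hw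
  let e : Algebra.adjoin R (Set.range v) ≃ₐ[R] Algebra.adjoin R (Set.range w) :=
    hv.1.aevalEquiv.symm.trans hw.1.aevalEquiv
  refine ⟨IsAlgClosure.equivOfEquiv E E' e.toRingEquiv, fun r => ?_⟩
  have := IsAlgClosure.equivOfEquiv_algebraMap E E' e.toRingEquiv (algebraMap R _ r)
  rw [← IsScalarTower.algebraMap_apply] at this
  rw [this]
  simp [← IsScalarTower.algebraMap_apply]

theorem Algebra.trdeg_eq_aleph0_of_trdeg_lt_aleph0 {k A F : Type*} [Field k] [CommRing A]
    [Field F] [Algebra k A] [Algebra k F] [Algebra A F] [IsScalarTower k A F] [FaithfulSMul A F]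
    (hF : Algebra.trdeg k F = ℵ₀) (hA : Algebra.trdeg k A < ℵ₀) :
    Algebra.trdeg A F = ℵ₀ := by
  have : Nontrivial A := (algebraMap A F).domain_nontrivial
  have h := lift_trdeg_add_eq k A F
  rw [hF, lift_aleph0] at h
  have hA' : lift (trdeg k A) < ℵ₀ := by simpa using hA
  have := Cardinal.eq_of_add_eq_of_aleph0_le h hA' le_rfl
  simpa using this

/-- Two embeddings into `F` of a `k`-algebra of finite transcendence degree differ by an
automorphism of `F` over `k`. -/
theorem exists_algEquiv_apply_eq_of_trdeg_lt_aleph0 {k F A : Type*} [Field k] [Field F]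
    [Algebra k F] [IsAlgClosed F] (hF : Algebra.trdeg k F = ℵ₀) [CommRing A] [Algebra k A]
    (hA : Algebra.trdeg k A < ℵ₀)
    {φ ψ : A →ₐ[k] F} (hφ : Function.Injective φ) (hψ : Function.Injective ψ) :
    ∃ σ : F ≃ₐ[k] F, ∀ a, σ (φ a) = ψ a := by
  have basis : ∀ {χ : A →ₐ[k] F}, Function.Injective χ →
      ∃ v : ℕ → F, @IsTranscendenceBasis ℕ A F _ _ χ.toRingHom.toAlgebra v := by
    intro χ hχ
    let := χ.toRingHom.toAlgebra
    have : IsScalarTower k A F := .of_algebraMap_eq fun r => (χ.commutes r).symm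
    have : FaithfulSMul A F := (faithfulSMul_iff_algebraMap_injective A F).mpr hχ
    have : Nontrivial A := (algebraMap A F).domain_nontrivial
    obtain ⟨s, hs⟩ := exists_isTranscendenceBasis A F
    have hcard := hs.cardinalMk_eq_trdeg
    rw [Algebra.trdeg_eq_aleph0_of_trdeg_lt_aleph0 hF hA, ← Cardinal.denumerable_iff] at hcard
    obtain ⟨h⟩ := hcard
    exact ⟨_, hs.comp_equiv (Denumerable.eqv s).symm⟩
  obtain ⟨v, hv⟩ := basis hφ
  obtain ⟨w, hw⟩ := basis hψ
  obtain ⟨σ, hσ⟩ : ∃ σ : F ≃+* F, ∀ a, σ (φ a) = ψ a :=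
    @IsAlgClosed.exists_ringEquiv_of_isTranscendenceBasis A F F _ _ _ φ.toRingHom.toAlgebra
      ψ.toRingHom.toAlgebra _ _ ℕ v w hv hw
  refine ⟨AlgEquiv.ofRingEquiv (f := σ) fun r => ?_, hσ⟩
  have := hσ (algebraMap k A r)
  rwa [φ.commutes, ψ.commutes] at this

section FieldTheory

variable {k F ι : Type*} [Field k] [Field F] [Algebra k F]

theorem Set.Finite.finiteType_adjoin {s : Set F} (hs : s.Finite) :
    Algebra.FiniteType k (Algebra.adjoin k s) :=
  (Subalgebra.fg_iff_finiteType _).mp ⟨hs.toFinset, by simp⟩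

theorem AlgebraicIndependent.mem_matroid_closure_iff {s : Set F} {a : F} :
    a ∈ (AlgebraicIndependent.matroid k F).closure s ↔ IsAlgebraic (Algebra.adjoin k s) a := by
  rw [AlgebraicIndependent.matroid_closure_eq]
  rfl

/-- A finite family is algebraically independent as soon as an algebraically independent family with
the same index set is algebraic over it. -/
theorem AlgebraicIndependent.of_forall_isAlgebraic_adjoin_range [Finite ι] {x y : ι → F}
    (hx : AlgebraicIndependent k x)
    (h : ∀ i, IsAlgebraic (Algebra.adjoin k (Set.range y)) (x i)) : AlgebraicIndependent k y := by
  let M := AlgebraicIndependent.matroid k F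
  have hX : M.Indep (Set.range x) := hx.to_subtype_range
  have hle : (Set.range x).encard ≤ M.eRk (Set.range y) := by
    rw [← M.eRk_closure_eq]
    refine hX.encard_le_eRk_of_subset ?_
    rintro _ ⟨i, rfl⟩
    exact AlgebraicIndependent.mem_matroid_closure_iff.mpr (h i)
  have hcard : (Set.range x).encard = (Set.univ : Set ι).encard := by
    rw [← Set.image_univ, hx.injective.injOn.encard_image]
  have hcard' : (Set.range y).encard ≤ (Set.univ : Set ι).encard := by
    rw [← Set.image_univ]
    exact Set.encard_image_le _ _
  have hY : M.Indep (Set.range y) :=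
    (M.isRkFinite_of_finite (Set.finite_range y)).indep_of_encard_le_eRk
      (hcard'.trans (hcard ▸ hle))
  have hinj : Function.Injective y := by
    rw [← Set.injOn_univ]
    refine Set.finite_univ.injOn_of_encard_image_eq (le_antisymm (Set.encard_image_le _ _) ?_)
    rw [Set.image_univ, ← hcard]
    exact hle.trans (M.eRk_le_encard _)
  exact (algebraicIndependent_subtype_range hinj).mp hY

/-- An element of `L` algebraic over a family that is algebraically independent over `L` is
constant. -/
theorem AlgebraicIndependent.mem_bot_of_isAlgebraic [IsAlgClosed k] {L : IntermediateField k F}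
    {t : ι → F} (ht : AlgebraicIndependent L t) {f : F} (hf : f ∈ L)
    (hft : IsAlgebraic (Algebra.adjoin k (Set.range t)) f) : f ∈ (⊥ : IntermediateField k F) := by
  by_contra hbot
  have htr : Transcendental k f := by
    intro hal
    obtain ⟨c, hc⟩ := IsAlgClosed.exists_algebraMap_eq_of_isAlgebraic hal
    exact hbot (IntermediateField.mem_bot.mpr ⟨c, hc⟩)
  have hf1 : AlgebraicIndependent k (fun _ : Unit => f) :=
    algebraicIndependent_unique_type_iff.mpr htr
  have h : AlgebraicIndependent k (Sum.elim t (fun _ : Unit => f)) :=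
    hf1.sumElim_of_tower (S := L) (by rintro _ ⟨_, rfl⟩; exact ⟨⟨f, hf⟩, rfl⟩) ht
  have h' : AlgebraicIndependent k (Sum.elim (fun _ : Unit => f) t) := by
    have := h.comp Sum.swap Sum.swap_leftInverse.injective
    convert this using 1
    ext (i | i) <;> rfl
  exact algebraicIndependent_unique_type_iff.mp (AlgebraicIndependent.sumElim_iff.mp h').2 hft

theorem exists_algebraicIndependent_adjoin (hF : Algebra.trdeg k F = ℵ₀) [Finite ι] {S : Set F}
    (hS : S.Finite) : ∃ a : ι → F, AlgebraicIndependent (IntermediateField.adjoin k S) a := by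
  have := hS.finiteType_adjoin (k := k)
  have hA : Algebra.trdeg k (Algebra.adjoin k S) < ℵ₀ := trdeg_lt_aleph0_of_finiteType
  obtain ⟨s, hs⟩ := exists_isTranscendenceBasis (Algebra.adjoin k S) F
  have hcard := hs.cardinalMk_eq_trdeg
  rw [Algebra.trdeg_eq_aleph0_of_trdeg_lt_aleph0 hF hA, ← Cardinal.denumerable_iff] at hcard
  obtain ⟨h⟩ := hcard
  obtain ⟨n, ⟨e⟩⟩ := Finite.exists_equiv_fin ι
  refine ⟨fun i => ((Denumerable.eqv s).symm (e i) : s),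
    IntermediateField.algebraicIndependent_adjoin_iff.mpr ?_⟩
  exact hs.1.comp _ ((Denumerable.eqv s).symm.injective.comp (Fin.val_injective.comp e.injective))

/-- A finite set `S` lies in an extension of the form `k(X, θ)` with `X` algebraically independent
and `θ` algebraic over `k(X)`; moreover `X` may be chosen to contain a given independent subset. -/
theorem exists_isAlgebraic_subset_adjoin_insert [CharZero k] {S T : Set F} (hS : S.Finite)
    (hTS : T ⊆ S) (hT : AlgebraicIndepOn k id T) :
    ∃ X : Set F, X.Finite ∧ T ⊆ X ∧ AlgebraicIndepOn k id X ∧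
      ∃ θ, IsAlgebraic (IntermediateField.adjoin k X) θ ∧
        S ⊆ IntermediateField.adjoin k (insert θ X) := by
  let M := AlgebraicIndependent.matroid k F
  have hT' : M.Indep T := hT
  obtain ⟨X, hX, hTX⟩ := hT'.subset_isBasis_of_subset hTS
  have hal : ∀ s ∈ S, IsAlgebraic (IntermediateField.adjoin k X) s := fun s hs =>
    IntermediateField.isAlgebraic_adjoin_iff.mpr
      (AlgebraicIndependent.mem_matroid_closure_iff.mp (hX.subset_closure hs))
  refine ⟨X, hS.subset hX.subset, hTX, hX.indep, ?_⟩
  have : Finite S := hS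
  have := IntermediateField.finiteDimensional_adjoin (K := IntermediateField.adjoin k X) (S := S)
    fun s hs => (hal s hs).isIntegral
  let E := IntermediateField.adjoin (IntermediateField.adjoin k X) S
  obtain ⟨θ, hθ⟩ := Field.exists_primitive_element (IntermediateField.adjoin k X) E
  have hE : IntermediateField.adjoin (IntermediateField.adjoin k X) {(θ : F)} = E := by
    have := congrArg (IntermediateField.map E.val) hθ
    rw [IntermediateField.adjoin_map, ← AlgHom.fieldRange_eq_map,
      IntermediateField.fieldRange_val] at this
    simpa using this
  refine ⟨θ, ?_, ?_⟩
  · exact (Algebra.IsAlgebraic.isAlgebraic (R := IntermediateField.adjoin k X) θ).algebraMap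
  · intro s hs
    have h1 : s ∈ E := IntermediateField.subset_adjoin _ _ hs
    rw [← hE, ← IntermediateField.mem_restrictScalars (K := k),
      IntermediateField.adjoin_adjoin_left] at h1
    rwa [← Set.union_singleton]

theorem IsAlgebraic.map_adjoin {R K A D : Type*} [CommRing R] [CommRing K] [CommRing A]
    [CommRing D] [Algebra R K] [Algebra R A] [Algebra R D] [Algebra K D] [IsScalarTower R K D]
    (g : A →ₐ[R] D) (hg : Function.Injective g) {s : Set A} {t : Set D} (hst : ∀ a ∈ s, g a ∈ t)
    {a : A} (ha : IsAlgebraic (Algebra.adjoin R s) a) : IsAlgebraic (Algebra.adjoin K t) (g a) := by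
  have hmem : ∀ b : Algebra.adjoin R s, g b ∈ Algebra.adjoin K t := by
    rintro ⟨b, hb⟩
    induction hb using Algebra.adjoin_induction with
    | mem a ha => exact Algebra.subset_adjoin (hst a ha)
    | algebraMap r =>
      have h := (Algebra.adjoin K t).algebraMap_mem (algebraMap R K r)
      rwa [← IsScalarTower.algebraMap_apply, ← g.commutes] at h
    | add a b _ _ ha hb => simpa using add_mem ha hb
    | mul a b _ _ ha hb => simpa using mul_mem ha hb
  let f : Algebra.adjoin R s →+* Algebra.adjoin K t :=
    ((g : A →+* D).comp (Algebra.adjoin R s).val.toRingHom).codRestrict (Algebra.adjoin K t) hmem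
  exact ha.ringHom_of_comp_eq f g
    (fun b c hbc => Subtype.ext (hg (congrArg Subtype.val hbc))) rfl

theorem IsAlgebraic.of_map_adjoin {R A D : Type*} [CommRing R] [CommRing A] [CommRing D]
    [Algebra R A] [Algebra R D] (g : A →ₐ[R] D) (hg : Function.Injective g) {s : Set A} {a : A}
    (ha : IsAlgebraic (Algebra.adjoin R (g '' s)) (g a)) : IsAlgebraic (Algebra.adjoin R s) a := by
  have hmem : ∀ b : Algebra.adjoin R s, g b ∈ Algebra.adjoin R (g '' s) := by
    intro b
    rw [← AlgHom.map_adjoin]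
    exact ⟨b, b.2, rfl⟩
  let f : Algebra.adjoin R s →+* Algebra.adjoin R (g '' s) :=
    ((g : A →+* D).comp (Algebra.adjoin R s).val.toRingHom).codRestrict _ hmem
  refine ha.of_ringHom_of_comp_eq f g ?_ hg rfl
  rintro ⟨b, hb⟩
  rw [← AlgHom.map_adjoin] at hb
  obtain ⟨c, hc, rfl⟩ := hb
  exact ⟨⟨c, hc⟩, rfl⟩

theorem AlgEquiv.apply_eq_of_mem_adjoin {s : Set F} {g h : F ≃ₐ[k] F} (hs : ∀ a ∈ s, g a = h a)
    {f : F} (hf : f ∈ IntermediateField.adjoin k s) : g f = h f := by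
  induction hf using IntermediateField.adjoin_induction with
  | mem a ha => exact hs a ha
  | algebraMap c => simp
  | add a b _ _ ha hb => simp [ha, hb]
  | inv a _ ha => simp [ha]
  | mul a b _ _ ha hb => simp [ha, hb]

theorem mem_fixingSubgroup_adjoin_iff {s : Set F} {g : F ≃ₐ[k] F} :
    g ∈ (IntermediateField.adjoin k s).fixingSubgroup ↔ ∀ a ∈ s, g a = a := by
  rw [IntermediateField.mem_fixingSubgroup_iff]
  exact ⟨fun h a ha => h a (IntermediateField.subset_adjoin k s ha),
    fun h a ha => AlgEquiv.apply_eq_of_mem_adjoin (h := .refl) h ha⟩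

theorem isAlgebraic_of_mem_adjoin_insert {s : Set F} {y : F}
    (hy : IsAlgebraic (Algebra.adjoin k s) y) {f : F}
    (hf : f ∈ IntermediateField.adjoin k (insert y s)) : IsAlgebraic (Algebra.adjoin k s) f := by
  induction hf using IntermediateField.adjoin_induction with
  | mem a ha =>
    rcases ha with rfl | ha
    · exact hy
    · exact isAlgebraic_algebraMap (⟨a, Algebra.subset_adjoin ha⟩ : Algebra.adjoin k s)
  | algebraMap c => exact isAlgebraic_algebraMap (algebraMap k (Algebra.adjoin k s) c)
  | add a b _ _ ha hb => exact ha.add hb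
  | inv a _ ha => exact ha.inv
  | mul a b _ _ ha hb => exact ha.mul hb

/-- The multiplication map `a ⊗ b ↦ a * g b` on the coordinate ring `k[x, y]` is injective when the
conjugate `g x` is generic over `k(x, y)`. -/
theorem productMap_injective_of_algebraicIndependent [IsAlgClosed k] [Finite ι] {x : ι → F} {y : F}
    (hy : IsAlgebraic (Algebra.adjoin k (Set.range x)) y) (g : F ≃ₐ[k] F)
    (hg : AlgebraicIndependent (IntermediateField.adjoin k (insert y (Set.range x)))
      (fun i => g (x i))) :
    Function.Injective (Algebra.TensorProduct.productMap
      (Algebra.adjoin k (insert y (Set.range x))).val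
      ((g : F →ₐ[k] F).comp (Algebra.adjoin k (insert y (Set.range x))).val)) := by
  set A := Algebra.adjoin k (insert y (Set.range x)) with hAdef
  set m := Algebra.TensorProduct.productMap A.val ((g : F →ₐ[k] F).comp A.val) with hm
  have : Algebra.FiniteType k A := (Set.toFinite (insert y (Set.range x))).finiteType_adjoin
  have := Algebra.TensorProduct.isDomain_of_isAlgClosed k A A
  let x' : ι → A := fun i => ⟨x i, Algebra.subset_adjoin (Or.inr ⟨i, rfl⟩)⟩
  let t : ι → A ⊗[k] A := fun i => 1 ⊗ₜ x' i
  have halg : ∀ d : A ⊗[k] A, IsAlgebraic (Algebra.adjoin A (Set.range t)) d := by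
    intro d
    induction d with
    | zero => exact isAlgebraic_zero
    | add c d hc hd => exact hc.add hd
    | tmul a b =>
      have h1 : IsAlgebraic (Algebra.adjoin k (A.val '' Set.range x')) (A.val b) := by
        rw [← Set.range_comp]
        exact isAlgebraic_of_mem_adjoin_insert hy
          (IntermediateField.algebra_adjoin_le_adjoin _ _ b.2)
      have h2 := (IsAlgebraic.of_map_adjoin A.val Subtype.val_injective h1).map_adjoin (K := A)
        (t := Set.range t) (Algebra.TensorProduct.includeRight (R := k) (A := A) (B := A))
        (Algebra.TensorProduct.includeRight_injective (algebraMap k A).injective)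
        (by rintro _ ⟨i, rfl⟩; exact ⟨i, rfl⟩)
      have h3 : IsAlgebraic (Algebra.adjoin A (Set.range t)) (a ⊗ₜ[k] (1 : A)) :=
        isAlgebraic_algebraMap (algebraMap A (Algebra.adjoin A (Set.range t)) a)
      simpa using h3.mul h2
  have hgA : AlgebraicIndependent A (fun i => g (x i)) :=
    IntermediateField.algebraicIndependent_adjoin_iff.mp hg
  have hmA : ∀ p : MvPolynomial ι A, m (MvPolynomial.aeval t p) =
      MvPolynomial.aeval (fun i => g (x i)) p := by
    intro p
    induction p using MvPolynomial.induction_on with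
    | C a => simp [m, Algebra.TensorProduct.algebraMap_apply]
    | add p q hp hq => simp [hp, hq]
    | mul_X p i hp => simp [hp]; simp [m, t, x']
  rw [injective_iff_map_eq_zero]
  intro d hd
  by_contra hd0
  refine Ideal.comap_ne_bot_of_algebraic_mem (I := RingHom.ker m) hd0 hd (halg d) ?_
  rw [eq_bot_iff]
  rintro ⟨b, hb⟩ hbm
  rw [Algebra.adjoin_range_eq_range_aeval] at hb
  obtain ⟨p, rfl⟩ := hb
  have : MvPolynomial.aeval (fun i => g (x i)) p = 0 := (hmA p).symm.trans hbm
  obtain rfl : p = 0 := (injective_iff_map_eq_zero _).mp hgA p this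
  exact Subtype.ext (map_zero (MvPolynomial.aeval t))

/-- Given `y` algebraic over `k(x)`, the slope and intercept coordinates of a generic line through
`(x, y)` generate a purely transcendental field over which `y` is algebraic; the automorphisms over
this field act on the conjugates of `y` in a doubly transitive way, and only constants of `k(x, y)`
are fixed by an automorphism moving `y`. -/
theorem exists_generic_line [IsAlgClosed k] [IsAlgClosed F]
    (hF : Algebra.trdeg k F = ℵ₀) [Finite ι] {x : ι → F} (hx : AlgebraicIndependent k x) {y : F}
    (hy : IsAlgebraic (Algebra.adjoin k (Set.range x)) y) :
    ∃ z : ι ⊕ ι → F, AlgebraicIndependent k z ∧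
      IsAlgebraic (IntermediateField.adjoin k (Set.range z)) y ∧
      (∀ g ∈ (IntermediateField.adjoin k (Set.range z)).fixingSubgroup, g y = y →
        ∀ f ∈ IntermediateField.adjoin k (insert y (Set.range x)), g f = f) ∧
      (∀ g ∈ (IntermediateField.adjoin k (Set.range z)).fixingSubgroup, g y ≠ y →
        ∀ f ∈ IntermediateField.adjoin k (insert y (Set.range x)), g f = f →
          f ∈ (⊥ : IntermediateField k F)) ∧
      (∀ g ∈ (IntermediateField.adjoin k (Set.range z)).fixingSubgroup, g y ≠ y →
        ∀ h ∈ (IntermediateField.adjoin k (Set.range z)).fixingSubgroup, h y ≠ y →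
          ∃ σ ∈ (IntermediateField.adjoin k (Set.range z)).fixingSubgroup,
            σ y = y ∧ σ (g y) = h y) := by
  set L := IntermediateField.adjoin k (insert y (Set.range x)) with hL
  have hyL : y ∈ L := IntermediateField.subset_adjoin _ _ (Or.inl rfl)
  have hxL : ∀ i, x i ∈ L := fun i => IntermediateField.subset_adjoin _ _ (Or.inr ⟨i, rfl⟩)
  obtain ⟨a, ha⟩ := exists_algebraicIndependent_adjoin (ι := ι) hF
    (Set.toFinite (insert y (Set.range x)))
  let z : ι ⊕ ι → F := Sum.elim a fun i => x i - a i * y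
  have hza : ∀ i, a i ∈ Algebra.adjoin k (Set.range z) :=
    fun i => Algebra.subset_adjoin ⟨.inl i, rfl⟩
  have hzh : ∀ i, x i - a i * y ∈ Algebra.adjoin k (Set.range z) :=
    fun i => Algebra.subset_adjoin ⟨.inr i, rfl⟩
  have hfix : ∀ g : F ≃ₐ[k] F,
      g ∈ (IntermediateField.adjoin k (Set.range z)).fixingSubgroup ↔
        ∀ i, g (a i) = a i ∧ g (x i - a i * y) = x i - a i * y := by
    intro g
    rw [mem_fixingSubgroup_adjoin_iff, Set.forall_mem_range, Sum.forall]
    exact forall_and.symm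
  have hyal : IsAlgebraic (Algebra.adjoin k (Set.range z)) y := by
    by_contra htr
    have := Set.Finite.finiteType_adjoin (k := k) (Set.finite_range z)
    have : Algebra.FiniteType k (Polynomial (Algebra.adjoin k (Set.range z))) :=
      Algebra.FiniteType.trans (S := Algebra.adjoin k (Set.range z)) inferInstance inferInstance
    have htr' : Transcendental (Algebra.adjoin k (Set.range z)) (y + 1) := by
      intro h
      exact htr (by simpa using h.sub isAlgebraic_one)
    obtain ⟨τ, hτ⟩ := exists_algEquiv_apply_eq_of_trdeg_lt_aleph0 hF
      (A := Polynomial (Algebra.adjoin k (Set.range z))) trdeg_lt_aleph0_of_finiteType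
      (φ := (Polynomial.aeval y).restrictScalars k)
      (ψ := (Polynomial.aeval (y + 1)).restrictScalars k)
      (transcendental_iff_injective.mp htr) (transcendental_iff_injective.mp htr')
    have hτy : τ y = y + 1 := by simpa using hτ Polynomial.X
    have hτz : ∀ b ∈ Algebra.adjoin k (Set.range z), τ b = b := by
      intro b hb
      simpa using hτ (Polynomial.C ⟨b, hb⟩)
    have hτx : ∀ i, τ (x i) = x i + a i := by
      intro i
      have h := hτz _ (hzh i)
      rw [map_sub, map_mul, hτz _ (hza i), hτy] at h
      linear_combination h
    have h1 : IsAlgebraic (Algebra.adjoin k (Set.range fun i => x i + a i)) (y + 1) := by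
      rw [← hτy]
      exact hy.map_adjoin (τ : F →ₐ[k] F) τ.injective
        (by rintro _ ⟨i, rfl⟩; exact ⟨i, (hτx i).symm⟩)
    have h2 : AlgebraicIndependent L (fun i => x i + a i) := by
      refine ha.of_forall_isAlgebraic_adjoin_range fun i => ?_
      have h3 : a i ∈ Algebra.adjoin L (Set.range fun i => x i + a i) := by
        have := sub_mem (Algebra.subset_adjoin ⟨i, rfl⟩ : x i + a i ∈ Algebra.adjoin L
          (Set.range fun i => x i + a i)) (Subalgebra.algebraMap_mem _ (⟨x i, hxL i⟩ : L))
        simpa using this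
      exact isAlgebraic_algebraMap (⟨_, h3⟩ : Algebra.adjoin L (Set.range fun i => x i + a i))
    have h4 := h2.mem_bot_of_isAlgebraic (add_mem hyL (one_mem L)) h1
    obtain ⟨c, hc⟩ := IntermediateField.mem_bot.mp (sub_mem h4 (one_mem _))
    rw [add_sub_cancel_right] at hc
    exact htr (hc ▸ isAlgebraic_algebraMap (algebraMap k (Algebra.adjoin k (Set.range z)) c))
  have hzind : AlgebraicIndependent k z := by
    have hax : AlgebraicIndependent k (Sum.elim a x) := hx.sumElim_of_tower (S := L)
      (by rintro _ ⟨i, rfl⟩; exact ⟨⟨x i, hxL i⟩, rfl⟩) ha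
    refine hax.of_forall_isAlgebraic_adjoin_range ?_
    rintro (i | i)
    · exact isAlgebraic_algebraMap (⟨_, hza i⟩ : Algebra.adjoin k (Set.range z))
    · have h1 : IsAlgebraic (Algebra.adjoin k (Set.range z)) (x i - a i * y) :=
        isAlgebraic_algebraMap (⟨_, hzh i⟩ : Algebra.adjoin k (Set.range z))
      have h2 : IsAlgebraic (Algebra.adjoin k (Set.range z)) (a i) :=
        isAlgebraic_algebraMap (⟨_, hza i⟩ : Algebra.adjoin k (Set.range z))
      simpa using h1.add (h2.mul hyal)
  have hgx : ∀ g ∈ (IntermediateField.adjoin k (Set.range z)).fixingSubgroup, ∀ i,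
      g (x i) = x i - a i * y + a i * g y := by
    intro g hg i
    obtain ⟨h1, h2⟩ := (hfix g).mp hg i
    rw [map_sub, map_mul, h1] at h2
    linear_combination h2
  have hgen : ∀ g ∈ (IntermediateField.adjoin k (Set.range z)).fixingSubgroup, g y ≠ y →
      AlgebraicIndependent L (fun i => g (x i)) := by
    intro g hg hgy
    refine ha.of_forall_isAlgebraic_adjoin_range fun i => ?_
    have h1 : IsAlgebraic (Algebra.adjoin L (Set.range fun i => g (x i))) (g y) :=
      hy.map_adjoin (g : F →ₐ[k] F) g.injective (by rintro _ ⟨i, rfl⟩; exact ⟨i, rfl⟩)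
    have h2 : ∀ b ∈ L, IsAlgebraic (Algebra.adjoin L (Set.range fun i => g (x i))) b := fun b hb =>
      isAlgebraic_algebraMap
        (algebraMap L (Algebra.adjoin L (Set.range fun i => g (x i))) ⟨b, hb⟩)
    have h3 : IsAlgebraic (Algebra.adjoin L (Set.range fun i => g (x i))) (g (x i)) :=
      isAlgebraic_algebraMap (⟨_, Algebra.subset_adjoin ⟨i, rfl⟩⟩ :
        Algebra.adjoin L (Set.range fun i => g (x i)))
    have h4 : a i = (g (x i) - x i) * (g y - y)⁻¹ := by
      rw [eq_mul_inv_iff_mul_eq₀ (sub_ne_zero.mpr hgy), hgx g hg i]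
      ring
    rw [h4]
    exact (h3.sub (h2 _ (hxL i))).mul (h1.sub (h2 _ hyL)).inv
  refine ⟨z, hzind, IntermediateField.isAlgebraic_adjoin_iff.mpr hyal, ?_, ?_, ?_⟩
  · intro g hg hgy f hf
    refine AlgEquiv.apply_eq_of_mem_adjoin (h := .refl) ?_ hf
    rintro _ (rfl | ⟨i, rfl⟩)
    · exact hgy
    · rw [hgx g hg, hgy]
      simp
  · intro g hg hgy f hf hgf
    refine (hgen g hg hgy).mem_bot_of_isAlgebraic hf ?_
    rw [← hgf]
    exact (isAlgebraic_of_mem_adjoin_insert hy hf).map_adjoin (g : F →ₐ[k] F) g.injective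
      (by rintro _ ⟨i, rfl⟩; exact ⟨i, rfl⟩)
  · intro g hg hgy h hh hhy
    set A := Algebra.adjoin k (insert y (Set.range x))
    have := Set.Finite.finiteType_adjoin (k := k) (Set.toFinite (insert y (Set.range x)))
    have : Algebra.FiniteType k (A ⊗[k] A) :=
      Algebra.FiniteType.trans (S := A) inferInstance inferInstance
    obtain ⟨σ, hσ⟩ := exists_algEquiv_apply_eq_of_trdeg_lt_aleph0 hF (A := A ⊗[k] A)
      trdeg_lt_aleph0_of_finiteType
      (productMap_injective_of_algebraicIndependent hy g (hgen g hg hgy))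
      (productMap_injective_of_algebraicIndependent hy h (hgen h hh hhy))
    have hyA : y ∈ A := Algebra.subset_adjoin (Or.inl rfl)
    have hxA : ∀ i, x i ∈ A := fun i => Algebra.subset_adjoin (Or.inr ⟨i, rfl⟩)
    have hl : ∀ b ∈ A, σ b = b := by
      intro b hb
      simpa using hσ ((⟨b, hb⟩ : A) ⊗ₜ 1)
    have hr : ∀ b ∈ A, σ (g b) = h b := by
      intro b hb
      simpa using hσ (1 ⊗ₜ (⟨b, hb⟩ : A))
    have hσa : ∀ i, σ (a i) = a i := by
      intro i
      have hx1 := congrArg σ (hgx g hg i)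
      rw [hr _ (hxA i), hgx h hh i] at hx1
      simp only [map_add, map_sub, map_mul, hl _ (hxA i), hl _ hyA, hr _ hyA] at hx1
      have : (h y - y) * (σ (a i) - a i) = 0 := by linear_combination -hx1
      exact sub_eq_zero.mp ((mul_eq_zero.mp this).resolve_left (sub_ne_zero.mpr hhy))
    refine ⟨σ, (hfix σ).mpr fun i => ⟨hσa i, ?_⟩, hl _ hyA, hr _ hyA⟩
    rw [map_sub, map_mul, hσa, hl _ (hxA i), hl _ hyA]

end FieldTheory

section Averaging

variable {k X V : Type*} [Field k] [Fintype X] [DecidableEq X] [AddCommGroup V]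
  [Module k V]

open Classical in
theorem Subgroup.card_smul_sum_apply_eq (K : Subgroup (Equiv.Perm X)) (T : Finset X)
    (hT : ∀ h ∈ K, ∀ t ∈ T, h t ∈ T) (htr : ∀ s ∈ T, ∀ t ∈ T, ∃ h ∈ K, h s = t) (f : X → V)
    {s : X} (hs : s ∈ T) :
    (T.card : k) • ∑ h : K, f (h.1 s) = (Fintype.card K : k) • ∑ t ∈ T, f t := by
  have hconst : ∀ t ∈ T, ∑ h : K, f (h.1 t) = ∑ h : K, f (h.1 s) := by
    intro t ht
    obtain ⟨h₀, h₀K, rfl⟩ := htr s hs t ht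
    exact Fintype.sum_equiv (Equiv.mulRight (⟨h₀, h₀K⟩ : K)) _ _ fun h => rfl
  have hperm : ∀ h : K, ∑ t ∈ T, f (h.1 t) = ∑ t ∈ T, f t := by
    intro h
    refine Finset.sum_bijective h.1 h.1.bijective (fun t => ⟨hT h h.2 t, fun ht => ?_⟩)
      fun _ _ => rfl
    simpa using hT _ (K.inv_mem h.2) _ ht
  calc (T.card : k) • ∑ h : K, f (h.1 s) = ∑ t ∈ T, ∑ h : K, f (h.1 t) := by
        rw [Finset.sum_congr rfl hconst, Finset.sum_const, Nat.cast_smul_eq_nsmul]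
    _ = ∑ h : K, ∑ t ∈ T, f (h.1 t) := Finset.sum_comm
    _ = _ := by
        rw [Finset.sum_congr rfl fun h _ => hperm h, Finset.sum_const, Nat.cast_smul_eq_nsmul,
          Finset.card_univ]

/-- If the sums of `B` over the graphs of all permutations in a doubly transitive group are equal
to `c`, then the diagonal entries of `B` are determined by its row sums and column sums. -/
theorem card_smul_sub_sum_sub_sum_add_eq_zero [CharZero k] (H : Subgroup (Equiv.Perm X)) (y : X)
    (htr : ∀ j l, ∃ h ∈ H, h j = l)
    (htr₂ : ∀ j l, j ≠ y → l ≠ y → ∃ h ∈ H, h y = y ∧ h j = l) (B : X → X → V) (c : V)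
    (hB : ∀ h ∈ H, ∑ j, B j (h j) = c) :
    (Fintype.card X : k) • B y y - ∑ l, B y l - ∑ j, B j y + c = 0 := by
  classical
  have hcard : ∀ K : Subgroup (Equiv.Perm X), (Fintype.card K : k) ≠ 0 := fun K => by
    exact_mod_cast Fintype.card_ne_zero
  have hsum : ∀ K ≤ H, ∑ j, ∑ h : K, B j (h.1 j) = (Fintype.card K : k) • c := by
    intro K hK
    rw [Finset.sum_comm, Finset.sum_congr rfl fun h _ => hB h.1 (hK h.2), Finset.sum_const,
      Nat.cast_smul_eq_nsmul, Finset.card_univ]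
  have htotal : ∑ j, ∑ l, B j l = (Fintype.card X : k) • c := by
    refine smul_right_injective V (hcard H) ?_
    have h := fun j => Subgroup.card_smul_sum_apply_eq (k := k) H Finset.univ (by simp)
      (by simpa using htr) (B j) (Finset.mem_univ j)
    dsimp only
    rw [Finset.smul_sum, ← Finset.sum_congr rfl fun j _ => h j, ← Finset.smul_sum, hsum H le_rfl,
      smul_comm, Finset.card_univ]
  let K := H ⊓ MulAction.stabilizer (Equiv.Perm X) y
  have hK : ∀ h : K, h.1 y = y := fun h => h.2.2
  have hoff : ∑ j ∈ Finset.univ.erase y, ∑ l ∈ Finset.univ.erase y, B j l =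
      ((Finset.univ.erase y).card : k) • (c - B y y) := by
    refine smul_right_injective V (hcard K) ?_
    have h := fun j (hj : j ∈ Finset.univ.erase y) =>
      Subgroup.card_smul_sum_apply_eq (k := k) K (Finset.univ.erase y)
        (by
          intro h hh t ht
          simp only [Finset.mem_erase, Finset.mem_univ, and_true] at ht ⊢
          exact fun h' => ht (h.injective (h'.trans (hK ⟨h, hh⟩).symm)))
        (by
          intro s hs t ht
          simp only [Finset.mem_erase, Finset.mem_univ, and_true] at hs ht
          obtain ⟨h, h1, h2, h3⟩ := htr₂ s t hs ht
          exact ⟨h, ⟨h1, h2⟩, h3⟩) (B j) hj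
    have hK' := hsum K inf_le_left
    rw [← Finset.add_sum_erase _ _ (Finset.mem_univ y),
      Finset.sum_congr rfl fun h _ => by rw [hK h], Finset.sum_const, Finset.card_univ,
      ← Nat.cast_smul_eq_nsmul k] at hK'
    dsimp only
    rw [Finset.smul_sum, ← Finset.sum_congr rfl h, ← Finset.smul_sum,
      eq_sub_of_add_eq' hK', ← smul_sub, smul_comm]
  have hN : (Fintype.card X : k) = (Finset.univ.erase y).card + 1 := by
    rw [← Finset.card_univ, ← Finset.card_erase_add_one (Finset.mem_univ y)]
    push_cast
    rfl
  have hsplit : ∑ j, ∑ l, B j l = ∑ l, B y l + ∑ j ∈ Finset.univ.erase y, B j y +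
      ∑ j ∈ Finset.univ.erase y, ∑ l ∈ Finset.univ.erase y, B j l := by
    rw [← Finset.add_sum_erase _ _ (Finset.mem_univ y), add_assoc, ← Finset.sum_add_distrib]
    congr 1
    exact Finset.sum_congr rfl fun j _ => (Finset.add_sum_erase _ _ (Finset.mem_univ y)).symm
  rw [htotal, hoff] at hsplit
  rw [← Finset.add_sum_erase _ (fun j => B j y) (Finset.mem_univ y)]
  simp only [hN, add_smul, one_smul, smul_sub] at hsplit ⊢
  rw [← sub_eq_zero] at hsplit
  rw [← hsplit]
  abel

end Averaging

section Representations

variable {k F : Type*} [Field k] [Field F] [Algebra k F]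
  {W : Type u} [AddCommGroup W] [Module k W]

theorem IsSmoothRep.exists_finset {ρ : (F ≃ₐ[k] F) →* (W ≃ₗ[k] W)} (hρ : IsSmoothRep ρ) (w : W) :
    ∃ S : Finset F, ∀ g : F ≃ₐ[k] F, (∀ s ∈ S, g s = s) → ρ g w = w := by
  let _ : TopologicalSpace F := ⊥
  obtain ⟨U, hU, hUw⟩ := isOpen_induced_iff.mp (hρ w)
  have h1 : (fun x : F => x) ∈ U := by
    have : (1 : F ≃ₐ[k] F) ∈ {g : F ≃ₐ[k] F | ρ g w = w} := by simp
    rwa [← hUw] at this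
  obtain ⟨S, t, ht, hS⟩ := isOpen_pi_iff.mp hU _ h1
  refine ⟨S, fun g hg => ?_⟩
  have : g ∈ (fun (g : F ≃ₐ[k] F) (x : F) => g x) ⁻¹' U := by
    refine hS fun s hs => ?_
    change g s ∈ t s
    rw [hg s hs]
    exact (ht s hs).2
  rwa [hUw] at this

theorem IsHomotopyInvariantRep.fixedSubmodule_adjoin {ρ : (F ≃ₐ[k] F) →* (W ≃ₗ[k] W)}
    (hρ : IsHomotopyInvariantRep ρ) {Z : Set F} (hZ : AlgebraicIndepOn k id Z) :
    fixedSubmodule ρ (IntermediateField.adjoin k Z).fixingSubgroup = fixedSubmodule ρ ⊤ := by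
  rw [← IntermediateField.fixingSubgroup_bot]
  refine (hρ ⊥ _ ⟨Z, ?_, ?_⟩).symm
  · have h : AlgebraicIndependent k ((↑) : Z → F) := hZ
    exact (Algebra.IsAlgebraic.algebraicIndependent_iff (R := k)
      (S := (⊥ : IntermediateField k F)) ..).mp h
  · rw [IntermediateField.restrictScalars_adjoin]
    refine le_antisymm (IntermediateField.adjoin_le_iff.mpr ?_)
      (IntermediateField.adjoin.mono _ _ _ Set.subset_union_right)
    exact Set.union_subset (bot_le (a := IntermediateField.adjoin k Z))
      (IntermediateField.subset_adjoin k Z)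

theorem finite_orbit_fixingSubgroup {M : IntermediateField k F} {θ : F} (hθ : IsAlgebraic M θ) :
    Finite (MulAction.orbit M.fixingSubgroup θ) := by
  refine ((minpoly M θ).rootSet_finite F).subset ?_
  rintro _ ⟨g, rfl⟩
  rw [Polynomial.mem_rootSet]
  refine ⟨minpoly.ne_zero hθ.isIntegral, ?_⟩
  let g' : F ≃ₐ[M] F := IntermediateField.fixingSubgroupEquiv M g
  have h : Polynomial.aeval (g' θ) (minpoly M θ) = 0 := by
    rw [Polynomial.aeval_algEquiv, AlgHom.comp_apply, minpoly.aeval]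
    simp
  exact h

/-- The action of `Aut(F/k)` on `F`, as a `k`-linear representation. -/
def naturalRep (k F : Type*) [Field k] [Field F] [Algebra k F] :
    (F ≃ₐ[k] F) →* (F ≃ₗ[k] F) where
  toFun g := g.toLinearEquiv
  map_one' := rfl
  map_mul' _ _ := rfl

theorem sum_orbit_mem_fixedSubmodule (ρ : (F ≃ₐ[k] F) →* (W ≃ₗ[k] W))
    {Γ : Subgroup (F ≃ₐ[k] F)} {θ : F} [Fintype (MulAction.orbit Γ θ)]
    {g : MulAction.orbit Γ θ → F ≃ₐ[k] F} (hgΓ : ∀ r, g r ∈ Γ) (hg : ∀ r, g r θ = r) {w : W}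
    (hw : ∀ γ ∈ Γ, γ θ = θ → ρ γ w = w) : ∑ r, ρ (g r) w ∈ fixedSubmodule ρ Γ := by
  intro γ hγ
  rw [map_sum]
  refine Fintype.sum_equiv (MulAction.toPerm (⟨γ, hγ⟩ : Γ)) _ _ fun r => ?_
  set r' : MulAction.orbit Γ θ := (⟨γ, hγ⟩ : Γ) • r
  have hr' : (r' : F) = γ r := rfl
  have h := hw ((g r')⁻¹ * (γ * g r)) (mul_mem (inv_mem (hgΓ r')) (mul_mem hγ (hgΓ r))) (by
    rw [AlgEquiv.mul_apply, AlgEquiv.mul_apply, hg, ← hr', ← hg r']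
    exact (g r').symm_apply_apply θ)
  rw [map_mul, map_mul, map_inv, LinearEquiv.mul_apply, LinearEquiv.mul_apply] at h
  have h' := congrArg (ρ (g r')) h
  rw [← LinearEquiv.mul_apply, mul_inv_cancel] at h'
  exact h'

end Representations

section Tensor

variable {k F : Type*} [Field k] [Field F] [Algebra k F]
  {W : Type u} [AddCommGroup W] [Module k W]

/-- The `F`-linear extension of a functional on `W` to `F ⊗ W`. -/
def tensorCoeff (F : Type*) [Field F] [Algebra k F] (l : W →ₗ[k] k) : F ⊗[k] W →ₗ[F] F :=
  (TensorProduct.AlgebraTensorModule.rid k F F).toLinearMap ∘ₗ l.baseChange F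

@[simp]
theorem tensorCoeff_tmul (l : W →ₗ[k] k) (f : F) (w : W) :
    tensorCoeff F l (f ⊗ₜ w) = algebraMap k F (l w) * f := by
  simp [tensorCoeff, Algebra.smul_def]

theorem one_tmul_injective : Function.Injective fun w : W => (1 : F) ⊗ₜ[k] w := by
  intro a b hab
  rw [← sub_eq_zero, ← Module.forall_dual_apply_eq_zero_iff k]
  intro l
  have h := congrArg (tensorCoeff F l) hab
  simp only [tensorCoeff_tmul, mul_one] at h
  rw [map_sub, sub_eq_zero]
  exact (algebraMap k F).injective h

/-- A tensor whose coefficients are all constant comes from `W`. -/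
theorem exists_eq_one_tmul_of_tensorCoeff_mem_bot {u : F ⊗[k] W}
    (hu : ∀ l : W →ₗ[k] k, tensorCoeff F l u ∈ (⊥ : IntermediateField k F)) :
    ∃ w : W, u = 1 ⊗ₜ w := by
  let b := Module.Free.chooseBasis k W
  let b' := Algebra.TensorProduct.basis F b
  have hrepr : ∀ (u : F ⊗[k] W) i, b'.repr u i = tensorCoeff F (b.coord i) u := by
    intro u i
    induction u with
    | zero => simp
    | add x y hx hy => simp [hx, hy]
    | tmul f w => simp [b', mul_comm]
  choose c hc using fun i => IntermediateField.mem_bot.mp (hu (b.coord i))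
  refine ⟨∑ i ∈ (b'.repr u).support, c i • b i, ?_⟩
  conv_lhs => rw [← b'.linearCombination_repr u, Finsupp.linearCombination_apply, Finsupp.sum]
  rw [TensorProduct.tmul_sum]
  refine Finset.sum_congr rfl fun i _ => ?_
  rw [hrepr, ← hc, TensorProduct.tmul_smul]
  simp [b']

/-- The two-variable action `f ⊗ w ↦ g f ⊗ ρ h w`. -/
def tensorAct (ρ : (F ≃ₐ[k] F) →* (W ≃ₗ[k] W)) (g h : F ≃ₐ[k] F) : F ⊗[k] W ≃ₗ[k] F ⊗[k] W :=
  TensorProduct.congr g.toLinearEquiv (ρ h)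

variable (ρ : (F ≃ₐ[k] F) →* (W ≃ₗ[k] W))

@[simp]
theorem tensorAct_tmul (g h : F ≃ₐ[k] F) (f : F) (w : W) :
    tensorAct ρ g h (f ⊗ₜ w) = g f ⊗ₜ ρ h w := rfl

theorem tensorAct_mul (g g' h h' : F ≃ₐ[k] F) (u : F ⊗[k] W) :
    tensorAct ρ (g * g') (h * h') u = tensorAct ρ g h (tensorAct ρ g' h' u) := by
  induction u with
  | zero => simp
  | add x y hx hy => simp [hx, hy]
  | tmul f w => simp

theorem tensorCoeff_tensorAct (l : W →ₗ[k] k) (g h : F ≃ₐ[k] F) (u : F ⊗[k] W) :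
    tensorCoeff F l (tensorAct ρ g h u) = g (tensorCoeff F (l ∘ₗ (ρ h).toLinearMap) u) := by
  induction u with
  | zero => simp
  | add x y hx hy => simp [hx, hy]
  | tmul f w => simp

theorem exists_eq_one_tmul_of_tensorAct_eq [IsAlgClosed k] [IsAlgClosed F] [CharZero k]
    (hF : Algebra.trdeg k F = ℵ₀) {u : F ⊗[k] W} (hu : ∀ g, tensorAct ρ g g u = u) :
    ∃ c ∈ fixedSubmodule ρ ⊤, u = 1 ⊗ₜ c := by
  suffices h : ∃ c, u = 1 ⊗ₜ c by
    obtain ⟨c, rfl⟩ := h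
    refine ⟨c, fun g _ => one_tmul_injective (k := k) (F := F) ?_, rfl⟩
    simpa using hu g
  refine exists_eq_one_tmul_of_tensorCoeff_mem_bot fun l => ?_
  obtain ⟨P, hP⟩ := TensorProduct.exists_finset u
  obtain ⟨X, hX, -, hXind, θ, hθ, hSX⟩ := exists_isAlgebraic_subset_adjoin_insert (k := k)
    (P.finite_toSet.image Prod.fst) (Set.empty_subset _) (algebraicIndependent_empty_type ..)
  set L := IntermediateField.adjoin k (insert θ X)
  have hcoeff : ∀ m : W →ₗ[k] k, tensorCoeff F m u ∈ L := by
    intro m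
    rw [hP, map_sum]
    refine sum_mem fun p hp => ?_
    rw [tensorCoeff_tmul]
    exact mul_mem (algebraMap_mem _ _) (hSX ⟨p, hp, rfl⟩)
  have : Finite X := hX
  obtain ⟨a, ha⟩ := exists_algebraicIndependent_adjoin (ι := X) hF (hX.insert θ)
  have hak : AlgebraicIndependent k a := ha.restrictScalars (algebraMap k L).injective
  obtain ⟨g, hg⟩ := exists_algEquiv_apply_eq_of_trdeg_lt_aleph0 hF (A := MvPolynomial X k)
    trdeg_lt_aleph0_of_finiteType (φ := MvPolynomial.aeval ((↑) : X → F))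
    (ψ := MvPolynomial.aeval a) hXind hak
  refine ha.mem_bot_of_isAlgebraic (hcoeff l) ?_
  rw [← hu g, tensorCoeff_tensorAct]
  refine (isAlgebraic_of_mem_adjoin_insert (IntermediateField.isAlgebraic_adjoin_iff.mp hθ)
    (hcoeff _)).map_adjoin (g : F →ₐ[k] F) g.injective fun x hx => ?_
  exact ⟨⟨x, hx⟩, by simpa using (hg (MvPolynomial.X ⟨x, hx⟩)).symm⟩

end Tensor

section Descent

variable {k F : Type*} [Field k] [Field F] [Algebra k F]
  {W : Type u} [AddCommGroup W] [Module k W] {W' : Type v} [AddCommGroup W'] [Module k W']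

theorem tensorCoeff_baseChange (l : W' →ₗ[k] k) (p : W →ₗ[k] W') (u : F ⊗[k] W) :
    tensorCoeff F l (p.baseChange F u) = tensorCoeff F (l ∘ₗ p) u := by
  induction u with
  | zero => simp
  | add x y hx hy => simp [hx, hy]
  | tmul f w => simp

variable [IsAlgClosed k] [IsAlgClosed F] [CharZero k]
  {ρ : (F ≃ₐ[k] F) →* (W ≃ₗ[k] W)} {ρ' : (F ≃ₐ[k] F) →* (W' ≃ₗ[k] W')} {φ : W →ₗ[k] F ⊗[k] W'}

theorem exists_sum_tensorAct_eq_one_tmul (hF : Algebra.trdeg k F = ℵ₀)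
    (hhi : IsHomotopyInvariantRep ρ) (hφ : ∀ g w, φ (ρ g w) = tensorAct ρ' g g (φ w))
    {Z : Set F} (hZ : AlgebraicIndepOn k id Z) {θ : F}
    [Fintype (MulAction.orbit (IntermediateField.adjoin k Z).fixingSubgroup θ)]
    {g : MulAction.orbit (IntermediateField.adjoin k Z).fixingSubgroup θ → F ≃ₐ[k] F}
    (hgΓ : ∀ r, g r ∈ (IntermediateField.adjoin k Z).fixingSubgroup) (hg : ∀ r, g r θ = r) {w : W}
    (hw : ∀ γ ∈ (IntermediateField.adjoin k Z).fixingSubgroup, γ θ = θ → ρ γ w = w) :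
    ∃ c ∈ fixedSubmodule ρ' ⊤, ∑ r, tensorAct ρ' (g r) (g r) (φ w) = 1 ⊗ₜ c := by
  have h := sum_orbit_mem_fixedSubmodule ρ hgΓ hg hw
  rw [hhi.fixedSubmodule_adjoin hZ] at h
  refine exists_eq_one_tmul_of_tensorAct_eq ρ' hF fun a => ?_
  simp_rw [← hφ, ← map_sum]
  rw [← hφ, h a trivial]

/-- The coefficients of `φ w` along functionals vanishing on the invariants of `W'` are
constant. -/
theorem tensorCoeff_mem_bot_of_forall_fixedSubmodule (hF : Algebra.trdeg k F = ℵ₀)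
    (hsm : IsSmoothRep ρ) (hsm' : IsSmoothRep ρ')
    (hhi : IsHomotopyInvariantRep ρ) (hhi' : IsHomotopyInvariantRep ρ')
    (hφ : ∀ g w, φ (ρ g w) = tensorAct ρ' g g (φ w)) (w : W) {l : W' →ₗ[k] k}
    (hl : ∀ c ∈ fixedSubmodule ρ' ⊤, l c = 0) :
    tensorCoeff F l (φ w) ∈ (⊥ : IntermediateField k F) := by
  classical
  set v := φ w with hv
  obtain ⟨P, hP⟩ := TensorProduct.exists_finset v
  choose S hS using hsm'.exists_finset
  obtain ⟨Sw, hSw⟩ := hsm.exists_finset w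
  obtain ⟨X, hX, -, hXind, y, hy, hSX⟩ := exists_isAlgebraic_subset_adjoin_insert (k := k)
    (Sw ∪ P.image Prod.fst ∪ P.biUnion fun p => S p.2).finite_toSet
    (Set.empty_subset _) (algebraicIndependent_empty_type ..)
  have : Finite X := hX
  obtain ⟨z, hz, hyz, hfix, hconst, htrans⟩ := exists_generic_line hF (x := ((↑) : X → F)) hXind
    (y := y) (by
      rw [Subtype.range_coe]
      exact IntermediateField.isAlgebraic_adjoin_iff.mp hy)
  rw [Subtype.range_coe] at hfix hconst
  set L := IntermediateField.adjoin k (insert y X)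
  set Γ := (IntermediateField.adjoin k (Set.range z)).fixingSubgroup with hΓ
  have hfixS : ∀ γ ∈ Γ, γ y = y →
      ∀ s ∈ Sw ∪ P.image Prod.fst ∪ P.biUnion fun p => S p.2, γ s = s :=
    fun γ hγ hγy s hs => hfix γ hγ hγy s (hSX hs)
  have hfixw : ∀ γ ∈ Γ, γ y = y → ρ γ w = w := fun γ hγ hγy =>
    hSw γ fun s hs => hfixS γ hγ hγy s (by simp [hs])
  have hfixP : ∀ γ ∈ Γ, γ y = y → ∀ p ∈ P, ρ' γ p.2 = p.2 := fun γ hγ hγy p hp =>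
    hS _ γ fun s hs => hfixS γ hγ hγy s
      (Finset.mem_union_right _ (Finset.mem_biUnion.mpr ⟨p, hp, hs⟩))
  have hPL : ∀ p ∈ P, p.1 ∈ L := fun p hp =>
    hSX (Finset.mem_coe.mpr (Finset.mem_union_left _
      (Finset.mem_union_right _ (Finset.mem_image_of_mem _ hp))))
  have hinv : fixedSubmodule ρ' Γ = fixedSubmodule ρ' ⊤ :=
    hhi'.fixedSubmodule_adjoin hz.to_subtype_range
  set f := tensorCoeff F l v with hf
  have hfL : f ∈ L := by
    rw [hf, hP, map_sum]
    refine sum_mem fun p hp => ?_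
    rw [tensorCoeff_tmul]
    exact mul_mem (algebraMap_mem _ _) (hPL p hp)
  by_cases hmove : ∃ g ∈ Γ, g y ≠ y
  swap
  · push Not at hmove
    suffices f = 0 by rw [this]; exact zero_mem _
    rw [hf, hP, map_sum]
    refine Finset.sum_eq_zero fun p hp => ?_
    rw [tensorCoeff_tmul, hl p.2 (hinv ▸ fun γ hγ => hfixP γ hγ (hmove γ hγ) p hp), map_zero,
      zero_mul]
  obtain ⟨g₀, hg₀, hg₀y⟩ := hmove
  refine hconst g₀ hg₀ hg₀y f hfL ?_
  have := finite_orbit_fixingSubgroup hyz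
  have := Fintype.ofFinite (MulAction.orbit Γ y)
  have hex : ∀ r : MulAction.orbit Γ y, ∃ g ∈ Γ, g y = r := by
    rintro ⟨_, g, rfl⟩
    exact ⟨g, g.2, rfl⟩
  choose g hgΓ hg using hex
  obtain ⟨c, hc, hsum⟩ := exists_sum_tensorAct_eq_one_tmul hF hhi hφ hz.to_subtype_range hgΓ hg
    hfixw
  rw [← hv] at hsum
  have hstab : ∀ a, ∀ h ∈ Γ, ∀ h' ∈ Γ, h y = h' y → tensorAct ρ' a h v = tensorAct ρ' a h' v := by
    intro a h hh h' hh' hhy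
    have hτ : (h'⁻¹ * h) y = y := by
      rw [AlgEquiv.mul_apply, hhy]
      exact h'.symm_apply_apply y
    have h1 : tensorAct ρ' 1 (h'⁻¹ * h) v = v := by
      conv_lhs => rw [hP]
      conv_rhs => rw [hP]
      rw [map_sum]
      refine Finset.sum_congr rfl fun p hp => ?_
      rw [tensorAct_tmul, hfixP _ (mul_mem (inv_mem hh') hh) hτ p hp, AlgEquiv.one_apply]
    calc tensorAct ρ' a h v = tensorAct ρ' (a * 1) (h' * (h'⁻¹ * h)) v := by simp
      _ = tensorAct ρ' a h' v := by rw [tensorAct_mul, h1]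
  let y₀ : MulAction.orbit Γ y := ⟨y, MulAction.mem_orbit_self y⟩
  have hgy₀ : g y₀ y = y := hg y₀
  have key := card_smul_sub_sum_sub_sum_add_eq_zero (k := k)
    (MulAction.toPermHom Γ (MulAction.orbit Γ y)).range y₀
    (fun j m => by
      obtain ⟨σ, hσ⟩ := MulAction.exists_smul_eq Γ j m
      exact ⟨_, ⟨σ, rfl⟩, hσ⟩)
    (fun j m hj hm => by
      obtain ⟨σ, hσ, hσy, hσj⟩ := htrans (g j) (hgΓ j)
        (fun h => hj (Subtype.ext ((hg j).symm.trans h))) (g m) (hgΓ m)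
        (fun h => hm (Subtype.ext ((hg m).symm.trans h)))
      rw [hg, hg] at hσj
      exact ⟨_, ⟨⟨σ, hσ⟩, rfl⟩, Subtype.ext hσy, Subtype.ext hσj⟩)
    (fun j m => tensorAct ρ' (g j) (g m) v) (1 ⊗ₜ c) (by
      rintro _ ⟨σ, rfl⟩
      have h := congrArg (tensorAct ρ' 1 σ) hsum
      rw [map_sum, tensorAct_tmul, hc _ trivial, AlgEquiv.one_apply] at h
      rw [← h]
      refine Finset.sum_congr rfl fun j _ => ?_
      rw [← tensorAct_mul, one_mul]
      refine hstab _ _ (hgΓ _) _ (mul_mem σ.2 (hgΓ j)) ?_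
      rw [hg, AlgEquiv.mul_apply, hg]
      rfl)
  have hcol : ∀ j, tensorCoeff F l (tensorAct ρ' (g j) (g y₀) v) = g j f := by
    intro j
    rw [hstab _ _ (hgΓ y₀) 1 (one_mem _) hgy₀, tensorCoeff_tensorAct, map_one]
    rfl
  have hrow : tensorCoeff F l (∑ m, tensorAct ρ' (g y₀) (g m) v) = 0 := by
    have h : ∑ m, tensorAct ρ' (g y₀) (g m) v =
        ∑ p ∈ P, g y₀ p.1 ⊗ₜ[k] ∑ m, ρ' (g m) p.2 := by
      simp_rw [TensorProduct.tmul_sum]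
      rw [Finset.sum_comm]
      refine Finset.sum_congr rfl fun m _ => ?_
      conv_lhs => rw [hP]
      rw [map_sum]
      rfl
    rw [h, map_sum]
    refine Finset.sum_eq_zero fun p hp => ?_
    rw [tensorCoeff_tmul, hl _ (hinv ▸ sum_orbit_mem_fixedSubmodule ρ' hgΓ hg
      fun γ hγ hγy => hfixP γ hγ hγy p hp), map_zero, zero_mul]
  have hNf : (Fintype.card (MulAction.orbit Γ y) : k) • f = ∑ j, g j f := by
    have h := congrArg (tensorCoeff F l) key
    rw [map_add, map_sub, map_sub, hrow, map_sum, tensorCoeff_tmul, hl c hc,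
      LinearMap.map_smul_of_tower, hcol, hfix _ (hgΓ y₀) hgy₀ f hfL, map_zero, map_zero, zero_mul,
      add_zero, sub_zero, sub_eq_zero] at h
    rw [h]
    exact Finset.sum_congr rfl fun j _ => hcol j
  have hsumf := sum_orbit_mem_fixedSubmodule (naturalRep k F) hgΓ hg (w := f)
    (fun γ hγ hγy => hfix γ hγ hγy f hfL)
  have h : g₀ (∑ j, g j f) = ∑ j, g j f := hsumf g₀ hg₀
  rw [← hNf, map_smul] at h
  have : Nonempty (MulAction.orbit Γ y) := ⟨y₀⟩
  exact smul_right_injective F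
    (Nat.cast_ne_zero (R := k).mpr (Fintype.card_ne_zero (α := MulAction.orbit Γ y))) h

/-- An equivariant map from `W` to `F ⊗ W'` takes values in `1 ⊗ W'`. -/
theorem exists_apply_eq_one_tmul (hF : Algebra.trdeg k F = ℵ₀)
    (hsm : IsSmoothRep ρ) (hsm' : IsSmoothRep ρ')
    (hhi : IsHomotopyInvariantRep ρ) (hhi' : IsHomotopyInvariantRep ρ')
    (hφ : ∀ g w, φ (ρ g w) = tensorAct ρ' g g (φ w)) (w : W) :
    ∃ w' : W', φ w = 1 ⊗ₜ w' := by
  set A := fixedSubmodule ρ' ⊤ with hA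
  obtain ⟨π, hπ⟩ := A.subtype.exists_leftInverse_of_injective A.ker_subtype
  set p : W' →ₗ[k] W' := A.subtype ∘ₗ π with hp
  have hpA : ∀ c ∈ A, p c = c := fun c hc => congrArg Subtype.val (LinearMap.congr_fun hπ ⟨c, hc⟩)
  obtain ⟨w₁, hw₁⟩ : ∃ w₁ : W', (LinearMap.id - p).baseChange F (φ w) = 1 ⊗ₜ w₁ := by
    refine exists_eq_one_tmul_of_tensorCoeff_mem_bot fun l => ?_
    rw [tensorCoeff_baseChange]
    refine tensorCoeff_mem_bot_of_forall_fixedSubmodule hF hsm hsm' hhi hhi' hφ w fun c hc => ?_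
    simp [hpA c hc]
  set u := p.baseChange F (φ w) with hu
  have hdecomp : φ w = 1 ⊗ₜ w₁ + u := by
    rw [← hw₁, hu, LinearMap.baseChange_sub]
    simp
  have hact : ∀ g, tensorAct ρ' g g u = tensorAct ρ' g 1 u := by
    intro g
    rw [hu]
    induction φ w with
    | zero => simp
    | add x y hx hy => simp [hx, hy]
    | tmul f x =>
      have h : ρ' g (p x) = p x := (π x).2 g trivial
      simp [h]
  suffices h : ∃ w₂ : W', u = 1 ⊗ₜ w₂ by
    obtain ⟨w₂, hw₂⟩ := h
    exact ⟨w₁ + w₂, by rw [hdecomp, hw₂, TensorProduct.tmul_add]⟩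
  refine exists_eq_one_tmul_of_tensorCoeff_mem_bot fun l => ?_
  set f := tensorCoeff F l u with hf
  by_contra hfbot
  have htr : Transcendental k f := fun halg =>
    hfbot (IntermediateField.mem_bot.mpr (IsAlgClosed.exists_algebraMap_eq_of_isAlgebraic halg))
  obtain ⟨S, hS⟩ := hsm.exists_finset w
  obtain ⟨X, hX, hfX, hXind, θ, hθ, hSX⟩ := exists_isAlgebraic_subset_adjoin_insert (k := k)
    (S := insert f S) (T := {f}) (S.finite_toSet.insert f) (by simp)
    (algebraicIndependent_unique_type_iff.mpr htr)
  have := finite_orbit_fixingSubgroup hθ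
  set Γ := (IntermediateField.adjoin k X).fixingSubgroup with hΓ
  have := Fintype.ofFinite (MulAction.orbit Γ θ)
  have hex : ∀ r : MulAction.orbit Γ θ, ∃ g ∈ Γ, g θ = r := by
    rintro ⟨_, g, rfl⟩
    exact ⟨g, g.2, rfl⟩
  choose g hgΓ hg using hex
  have hfixX : ∀ γ ∈ Γ, ∀ x ∈ X, γ x = x := fun γ hγ => mem_fixingSubgroup_adjoin_iff.mp hγ
  obtain ⟨c, -, hsum⟩ := exists_sum_tensorAct_eq_one_tmul hF hhi hφ hXind hgΓ hg (w := w)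
    (fun γ hγ hγθ => hS γ fun s hs => by
      refine AlgEquiv.apply_eq_of_mem_adjoin (h := .refl) ?_ (hSX (Set.mem_insert_of_mem f hs))
      rintro a (rfl | ha)
      exacts [hγθ, hfixX γ hγ a ha])
  have h := congrArg (tensorCoeff F l) hsum
  have hterm : ∀ r, tensorCoeff F l (tensorAct ρ' (g r) (g r) (φ w)) =
      algebraMap k F (l (ρ' (g r) w₁)) + f := by
    intro r
    rw [hdecomp, map_add, map_add, hact, tensorAct_tmul, tensorCoeff_tmul, map_one, mul_one,
      tensorCoeff_tensorAct, map_one]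
    congr 1
    exact hfixX _ (hgΓ r) f (hfX rfl)
  rw [map_sum, Finset.sum_congr rfl fun r _ => hterm r, Finset.sum_add_distrib, Finset.sum_const,
    ← map_sum, tensorCoeff_tmul, mul_one, ← eq_sub_iff_add_eq', ← map_sub, Finset.card_univ] at h
  refine htr ?_
  have : Nonempty (MulAction.orbit Γ θ) := ⟨⟨θ, MulAction.mem_orbit_self θ⟩⟩
  have hN : (Fintype.card (MulAction.orbit Γ θ) : k) ≠ 0 :=
    Nat.cast_ne_zero.mpr Fintype.card_ne_zero
  rw [← Nat.cast_smul_eq_nsmul k] at h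
  rw [← inv_smul_smul₀ hN f, h]
  exact (isAlgebraic_algebraMap _).smul _

end Descent

end Auxiliary

/-- Suppose `n = ∞`.  For homotopy invariant smooth `k`-linear representations `W`,
`W'` of `G = Aut(F/k)`, the base-change map `f ↦ id_F ⊗ f`, from `k`-linear
`G`-equivariant maps `W → W'` to `F`-linear `G`-equivariant maps
`F ⊗_k W → F ⊗_k W'` (with the semilinear actions `g(f ⊗ w) = g(f) ⊗ g(w)`),
is well defined and bijective. -/
theorem statement11 (k F : Type*) [Field k] [Field F] [Algebra k F]
    [IsAlgClosed k] [IsAlgClosed F] [CharZero k] [CharZero F]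
    (hn : ∃ x : ℕ → F, IsTranscendenceBasis k x)
    (W : Type u) (W' : Type v) [AddCommGroup W] [Module k W]
    [AddCommGroup W'] [Module k W']
    (ρ : (F ≃ₐ[k] F) →* (W ≃ₗ[k] W)) (ρ' : (F ≃ₐ[k] F) →* (W' ≃ₗ[k] W'))
    (hsm : IsSmoothRep ρ) (hsm' : IsSmoothRep ρ')
    (hhi : IsHomotopyInvariantRep ρ) (hhi' : IsHomotopyInvariantRep ρ') :
    (∀ f : W →ₗ[k] W', (∀ (g : F ≃ₐ[k] F) (w : W), f (ρ g w) = ρ' g (f w)) →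
      ∀ (g : F ≃ₐ[k] F) (x : F ⊗[k] W),
        LinearMap.baseChange F f (TensorProduct.congr g.toLinearEquiv (ρ g) x) =
          TensorProduct.congr g.toLinearEquiv (ρ' g) (LinearMap.baseChange F f x)) ∧
    (∀ Φ : F ⊗[k] W →ₗ[F] F ⊗[k] W',
      (∀ (g : F ≃ₐ[k] F) (x : F ⊗[k] W),
        Φ (TensorProduct.congr g.toLinearEquiv (ρ g) x) =
          TensorProduct.congr g.toLinearEquiv (ρ' g) (Φ x)) →
      ∃! f : W →ₗ[k] W', (∀ (g : F ≃ₐ[k] F) (w : W), f (ρ g w) = ρ' g (f w)) ∧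
        Φ = LinearMap.baseChange F f) := by
  constructor
  · intro f hf g x
    induction x with
    | zero => simp
    | add x y hx hy => simp [hx, hy]
    | tmul a w => simp [hf]
  · intro Φ hΦ
    obtain ⟨x, hx⟩ := hn
    have hF : Algebra.trdeg k F = Cardinal.aleph0 := by
      simpa using hx.lift_cardinalMk_eq_trdeg.symm
    have hinj := one_tmul_injective (k := k) (F := F) (W := W')
    let φ : W →ₗ[k] F ⊗[k] W' := Φ.restrictScalars k ∘ₗ TensorProduct.mk k F W 1
    have hφ : ∀ g w, φ (ρ g w) = tensorAct ρ' g g (φ w) := fun g w => by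
      have h := hΦ g (1 ⊗ₜ w)
      rw [TensorProduct.congr_tmul, AlgEquiv.toLinearEquiv_apply, map_one] at h
      exact h
    choose f hf using exists_apply_eq_one_tmul hF hsm hsm' hhi hhi' hφ
    have hfΦ : ∀ w, Φ (1 ⊗ₜ w) = 1 ⊗ₜ f w := hf
    let f' : W →ₗ[k] W' :=
      { toFun := f
        map_add' := fun a b => hinj (by
          simp only [← hf, TensorProduct.tmul_add, map_add])
        map_smul' := fun a b => hinj (by
          simp only [← hf, TensorProduct.tmul_smul, map_smul, RingHom.id_apply]) }
    refine ⟨f', ⟨fun g w => hinj ?_, ?_⟩, fun f₁ hf₁ => ?_⟩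
    · change (1 : F) ⊗ₜ f (ρ g w) = 1 ⊗ₜ[k] ρ' g (f w)
      rw [← hf, hφ, hf, tensorAct_tmul, map_one]
    · ext w
      exact hf w
    · ext w
      refine hinj ?_
      change (1 : F) ⊗ₜ f₁ w = 1 ⊗ₜ[k] f w
      rw [← hfΦ, hf₁.2, LinearMap.baseChange_tmul]
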